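/- Let (f_n) be the integer sequence defined by f_0 = 0, f_1 = 1 and f_n = Σ_{i=1}^{n−1} (2^i C_i − f_i) f_{n−i} for n ≥ 2, and let g_n = 2^n C_n, where C_i = (1/i)·binomial(2i−2, i−1). Then the ratio f_n / g_n converges to (3 − √3)/6 as n → ∞. -/

import Mathlib

/-- The Catalan number `C n = (1/n) * binomial (2n-2) (n-1)` (the division is exact;
`C 0 = 0`). -/
def catalanC (n : ℕ) : ℕ := (2 * n - 2).choose (n - 1) / n

open Filter Finset

theorem catalanC_zero : catalanC 0 = 0 := by simp [catalanC]

theorem catalanC_succ (n : ℕ) : catalanC (n + 1) = catalan n := by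
  rw [catalan_eq_centralBinom_div, Nat.centralBinom, catalanC]
  congr 2

theorem catalan_pos (n : ℕ) : 0 < catalan n := by
  have h := succ_mul_catalan_eq_centralBinom n
  have h' := Nat.centralBinom_pos n
  rw [← h] at h'
  exact Nat.pos_of_mul_pos_left h'

theorem catalan_succ_mul (n : ℕ) : (n + 2) * catalan (n + 1) = 2 * (2 * n + 1) * catalan n := by
  have h1 := succ_mul_catalan_eq_centralBinom n
  have h2 := succ_mul_catalan_eq_centralBinom (n + 1)
  have h3 := Nat.succ_mul_centralBinom_succ n
  rw [← h1, ← h2] at h3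
  refine Nat.eq_of_mul_eq_mul_left (Nat.succ_pos n) ?_
  rw [Nat.succ_eq_add_one]
  linarith

/-- The Catalan numbers `catalanC`, rescaled by their exponential growth rate. -/
noncomputable def scaledCatalan (n : ℕ) : ℝ := catalanC n / 4 ^ n

theorem scaledCatalan_zero : scaledCatalan 0 = 0 := by simp [scaledCatalan, catalanC_zero]

theorem scaledCatalan_succ (n : ℕ) : scaledCatalan (n + 1) = catalan n / 4 ^ (n + 1) := by
  rw [scaledCatalan, catalanC_succ]

theorem scaledCatalan_one : scaledCatalan 1 = 1 / 4 := by
  simp [scaledCatalan_succ 0]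

theorem scaledCatalan_succ_pos (n : ℕ) : 0 < scaledCatalan (n + 1) := by
  rw [scaledCatalan_succ]
  have := catalan_pos n
  positivity

theorem scaledCatalan_nonneg (n : ℕ) : 0 ≤ scaledCatalan n := by
  unfold scaledCatalan
  positivity

theorem sum_antidiagonal_scaledCatalan (n : ℕ) :
    ∑ p ∈ antidiagonal (n + 2), scaledCatalan p.1 * scaledCatalan p.2 =
      scaledCatalan (n + 2) := by
  rw [Finset.Nat.antidiagonal_succ_succ']
  simp only [sum_cons, sum_map, scaledCatalan_zero, zero_mul, mul_zero, zero_add]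
  rw [scaledCatalan_succ, catalan_succ', Nat.cast_sum, Finset.sum_div]
  refine Finset.sum_congr rfl fun p hp => ?_
  rw [← mem_antidiagonal.mp hp]
  simp only [Function.Embedding.prodMap, Function.Embedding.coeFn_mk, Prod.map,
    Nat.succ_eq_add_one, scaledCatalan_succ, Nat.cast_mul]
  field_simp
  ring

theorem scaledCatalan_succ_succ (n : ℕ) :
    scaledCatalan (n + 2) = (2 * n + 1) / (2 * n + 4) * scaledCatalan (n + 1) := by
  rw [scaledCatalan_succ, scaledCatalan_succ]
  have h : ((n : ℝ) + 2) * catalan (n + 1) = 2 * (2 * n + 1) * catalan n := by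
    exact_mod_cast catalan_succ_mul n
  have h' : (catalan (n + 1) : ℝ) = 2 * (2 * n + 1) * catalan n / (n + 2) := by
    rw [← h]; field_simp
  rw [h']
  field_simp
  ring

theorem sum_range_scaledCatalan (n : ℕ) :
    ∑ i ∈ range (n + 1), scaledCatalan i = 1 / 2 - 2 * (n + 1) * scaledCatalan (n + 1) := by
  induction n with
  | zero => simp [scaledCatalan_zero, scaledCatalan_one]; norm_num
  | succ n ih =>
    rw [Finset.sum_range_succ, ih, scaledCatalan_succ_succ]
    push_cast
    field_simp
    ring

theorem summable_scaledCatalan : Summable scaledCatalan := by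
  refine summable_of_sum_range_le (c := 1 / 2) scaledCatalan_nonneg fun n => ?_
  refine (Finset.sum_le_sum_of_subset_of_nonneg (Finset.range_mono n.le_succ)
    fun i _ _ => scaledCatalan_nonneg i).trans ?_
  rw [sum_range_scaledCatalan]
  have := scaledCatalan_nonneg (n + 1)
  have : 0 ≤ 2 * ((n : ℝ) + 1) * scaledCatalan (n + 1) := by positivity
  linarith

/-- If `u` satisfies a convolution recurrence `u = b * v` beyond index `1`, then the sums satisfy
the corresponding relation. -/
theorem tsum_eq_add_of_antidiagonal {u b v : ℕ → ℝ} (hu : Summable u)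
    (hb : Summable fun n => ‖b n‖) (hv : Summable fun n => ‖v n‖)
    (hu0 : u 0 = 0) (hb0 : b 0 = 0) (hv0 : v 0 = 0)
    (h : ∀ n, ∑ p ∈ antidiagonal (n + 2), b p.1 * v p.2 = u (n + 2)) :
    ∑' n, u n = u 1 + (∑' n, b n) * ∑' n, v n := by
  rw [tsum_mul_tsum_eq_tsum_sum_antidiagonal_of_summable_norm hb hv,
    ← hu.sum_add_tsum_nat_add 2,
    ← (summable_norm_sum_mul_antidiagonal_of_summable_norm hb hv).of_norm.sum_add_tsum_nat_add 2]
  simp only [h]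
  simp [Finset.sum_range_succ, hu0, hb0, hv0, Finset.Nat.antidiagonal_succ]

theorem tsum_scaledCatalan : ∑' n, scaledCatalan n = 1 / 2 := by
  have h := tsum_eq_add_of_antidiagonal summable_scaledCatalan summable_scaledCatalan.norm
    summable_scaledCatalan.norm scaledCatalan_zero scaledCatalan_zero scaledCatalan_zero
    sum_antidiagonal_scaledCatalan
  rw [scaledCatalan_one] at h
  nlinarith [sq_nonneg (∑' n, scaledCatalan n - 1 / 2)]

theorem tendsto_scaledCatalan_sub_div (i : ℕ) :
    Tendsto (fun n => scaledCatalan (n - i) / scaledCatalan n) atTop (nhds 1) := by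
  have step : Tendsto (fun n : ℕ => scaledCatalan (n + 1) / scaledCatalan (n + 2)) atTop
      (nhds 1) := by
    have h : Tendsto (fun n : ℕ => 1 + (3 / 2) / ((n : ℝ) + 1 / 2)) atTop (nhds (1 + 0)) :=
      tendsto_const_nhds.add (tendsto_const_nhds.div_atTop
        (tendsto_atTop_add_const_right _ _ tendsto_natCast_atTop_atTop))
    rw [add_zero] at h
    refine h.congr fun n => ?_
    have := (scaledCatalan_succ_pos n).ne'
    rw [scaledCatalan_succ_succ]
    field_simp
    ring
  induction i with
  | zero =>
    refine tendsto_const_nhds.congr' ?_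
    filter_upwards [eventually_ge_atTop 1] with n hn
    obtain ⟨m, rfl⟩ := Nat.exists_eq_add_of_le' hn
    exact (div_self (scaledCatalan_succ_pos m).ne').symm
  | succ i ih =>
    rw [← tendsto_add_atTop_iff_nat 2]
    have h := ((tendsto_add_atTop_iff_nat 1).mpr ih).mul step
    rw [one_mul] at h
    refine h.congr fun n => ?_
    have := (scaledCatalan_succ_pos n).ne'
    rw [div_mul_div_cancel₀ this]
    congr 2
    omega

/-- Replacing a sum by its first and last `M` terms costs at most the corresponding error for any
dominating sequence. -/
theorem abs_sum_sub_sum_ends_le {φ ψ : ℕ → ℝ} {n M : ℕ} (hM : 2 * M ≤ n + 1)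
    (h : ∀ i ≤ n, |φ i| ≤ ψ i) :
    |∑ i ∈ range (n + 1), φ i - ∑ i ∈ range M, (φ i + φ (n - i))| ≤
      ∑ i ∈ range (n + 1), ψ i - ∑ i ∈ range M, (ψ i + ψ (n - i)) := by
  obtain ⟨k, hk⟩ := Nat.exists_eq_add_of_le hM
  have key (x : ℕ → ℝ) : ∑ i ∈ range (n + 1), x i - ∑ i ∈ range M, (x i + x (n - i)) =
      ∑ i ∈ range k, x (M + i) := by
    have hn : n + 1 = M + k + M := by omega
    have hr : ∑ i ∈ range M, x (n - i) = ∑ i ∈ range M, x (M + k + i) := by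
      rw [← Finset.sum_range_reflect]
      refine Finset.sum_congr rfl fun i hi => ?_
      have := Finset.mem_range.mp hi
      congr 1
      omega
    rw [Finset.sum_add_distrib, hr, hn, Finset.sum_range_add, Finset.sum_range_add]
    ring
  rw [key, key]
  refine (Finset.abs_sum_le_sum_abs _ _).trans (Finset.sum_le_sum fun i hi => h _ ?_)
  have := Finset.mem_range.mp hi
  omega

section Ratio

variable {a : ℕ → ℝ}

theorem nonneg_and_le_scaledCatalan (ha0 : a 0 = 0) (ha1 : a 1 = 1 / 8)
    (ha : ∀ n, ∑ p ∈ antidiagonal (n + 2), (scaledCatalan p.1 - a p.1) * a p.2 = a (n + 2))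
    (n : ℕ) : 0 ≤ a n ∧ a n ≤ scaledCatalan n := by
  induction n using Nat.strong_induction_on with
  | _ n ih =>
    match n, ih with
    | 0, _ => simp [ha0, scaledCatalan_zero]
    | 1, _ => rw [ha1, scaledCatalan_one]; norm_num
    | n + 2, ih =>
      have hterm : ∀ p ∈ antidiagonal (n + 2), 0 ≤ (scaledCatalan p.1 - a p.1) * a p.2 ∧
          (scaledCatalan p.1 - a p.1) * a p.2 ≤ scaledCatalan p.1 * scaledCatalan p.2 := by
        intro p hp
        have hp := mem_antidiagonal.mp hp
        rcases Nat.eq_zero_or_pos p.1 with h1 | h1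
        · simp [h1, ha0, scaledCatalan_zero]
        rcases Nat.eq_zero_or_pos p.2 with h2 | h2
        · simp [h2, ha0, scaledCatalan_zero]
        obtain ⟨h3, h4⟩ := ih p.1 (by omega)
        obtain ⟨h5, h6⟩ := ih p.2 (by omega)
        exact ⟨mul_nonneg (by linarith) h5,
          mul_le_mul (by linarith) h6 h5 (scaledCatalan_nonneg _)⟩
      rw [← ha, ← sum_antidiagonal_scaledCatalan]
      exact ⟨Finset.sum_nonneg fun p hp => (hterm p hp).1,
        Finset.sum_le_sum fun p hp => (hterm p hp).2⟩

theorem tsum_eq_of_recurrence (ha0 : a 0 = 0) (ha1 : a 1 = 1 / 8)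
    (ha : ∀ n, ∑ p ∈ antidiagonal (n + 2), (scaledCatalan p.1 - a p.1) * a p.2 = a (n + 2)) :
    Summable a ∧ ∑' n, a n = (Real.sqrt 3 - 1) / 4 := by
  have hb := nonneg_and_le_scaledCatalan ha0 ha1 ha
  have hs : Summable a :=
    summable_scaledCatalan.of_nonneg_of_le (fun n => (hb n).1) fun n => (hb n).2
  refine ⟨hs, ?_⟩
  have h := tsum_eq_add_of_antidiagonal hs (summable_scaledCatalan.sub hs).norm hs.norm
    ha0 (by simp [ha0, scaledCatalan_zero]) ha0 ha
  rw [summable_scaledCatalan.tsum_sub hs, tsum_scaledCatalan, ha1] at h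
  have h0 : 0 ≤ ∑' n, a n := tsum_nonneg fun n => (hb n).1
  have h3 : Real.sqrt 3 = 4 * ∑' n, a n + 1 := by
    rw [Real.sqrt_eq_iff_mul_self_eq (by norm_num) (by linarith)]
    linarith
  linarith

/-- One step of the contraction towards the limit `L`, for a fixed number `M` of end terms. -/
theorem abs_ratio_sub_le {r : ℕ → ℝ} {L b T : ℝ} {M n : ℕ} (hr : ∀ n, 0 ≤ r n ∧ r n ≤ 1)
    (hL : |L - ∑ i ∈ range M, scaledCatalan i * (r i + (1 - 2 * r i) * L)| ≤ T)
    (hM : 2 * M ≤ n + 3) (hb0 : 0 ≤ b) (hb : ∀ i < M, |r (n + 2 - i) - L| ≤ b)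
    (hrec : r (n + 2) * scaledCatalan (n + 2) = ∑ p ∈ antidiagonal (n + 2),
      scaledCatalan p.1 * scaledCatalan p.2 * ((1 - r p.1) * r p.2)) :
    |r (n + 2) - L| ≤ b / 2 +
      (1 - 2 * ∑ i ∈ range M, scaledCatalan i *
          (scaledCatalan (n + 2 - i) / scaledCatalan (n + 2)) +
        ∑ i ∈ range M, scaledCatalan i *
          |scaledCatalan (n + 2 - i) / scaledCatalan (n + 2) - 1| + T) := by
  set N := n + 2 with hN
  have hc : 0 < scaledCatalan N := scaledCatalan_succ_pos (n + 1)
  set q : ℕ → ℝ := fun i => scaledCatalan (N - i) / scaledCatalan N with hq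
  have hrN : r N = ∑ i ∈ range (N + 1), scaledCatalan i * q i * ((1 - r i) * r (N - i)) := by
    rw [eq_comm, ← mul_left_inj' hc.ne', hrec, Finset.sum_mul,
      Finset.Nat.sum_antidiagonal_eq_sum_range_succ
        (fun i j => scaledCatalan i * scaledCatalan j * ((1 - r i) * r j))]
    refine Finset.sum_congr rfl fun i _ => ?_
    simp only [hq]
    field_simp
  have hone : 1 = ∑ i ∈ range (N + 1), scaledCatalan i * q i := by
    have h := sum_antidiagonal_scaledCatalan n
    rw [Finset.Nat.sum_antidiagonal_eq_sum_range_succ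
        (fun i j => scaledCatalan i * scaledCatalan j)] at h
    rw [← mul_left_inj' hc.ne', one_mul, Finset.sum_mul]
    refine h.symm.trans (Finset.sum_congr rfl fun i _ => ?_)
    simp only [hq]
    field_simp
    rw [hN]
  have hsymm (i : ℕ) (hi : i ≤ N) :
      scaledCatalan (N - i) * q (N - i) = scaledCatalan i * q i := by
    simp only [hq, Nat.sub_sub_self hi]
    ring
  have hq0 (i : ℕ) : 0 ≤ scaledCatalan i * q i :=
    mul_nonneg (scaledCatalan_nonneg _)
      (div_nonneg (scaledCatalan_nonneg _) (scaledCatalan_nonneg _))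
  have hends := abs_sum_sub_sum_ends_le (n := N) (M := M)
    (φ := fun i => scaledCatalan i * q i * ((1 - r i) * r (N - i)))
    (ψ := fun i => scaledCatalan i * q i) (by omega) (by
      intro i _
      obtain ⟨h1, h2⟩ := hr i
      obtain ⟨h3, h4⟩ := hr (N - i)
      have h5 : 0 ≤ (1 - r i) * r (N - i) := mul_nonneg (by linarith) h3
      rw [abs_of_nonneg (mul_nonneg (hq0 i) h5)]
      exact mul_le_of_le_one_right (hq0 i) (mul_le_one₀ (by linarith) h3 h4))
  rw [← hrN, ← hone] at hends
  have e1 : ∑ i ∈ range M, (scaledCatalan i * q i + scaledCatalan (N - i) * q (N - i)) =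
      2 * ∑ i ∈ range M, scaledCatalan i * q i := by
    rw [Finset.mul_sum]
    refine Finset.sum_congr rfl fun i hi => ?_
    have := Finset.mem_range.mp hi
    rw [hsymm i (by omega)]
    ring
  have e2 : |∑ i ∈ range M, (scaledCatalan i * q i * ((1 - r i) * r (N - i)) +
        scaledCatalan (N - i) * q (N - i) * ((1 - r (N - i)) * r (N - (N - i)))) -
        ∑ i ∈ range M, scaledCatalan i * (r i + (1 - 2 * r i) * L)| ≤
      ∑ i ∈ range M, scaledCatalan i * |q i - 1| + ∑ i ∈ range M, scaledCatalan i * b := by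
    rw [← Finset.sum_sub_distrib, ← Finset.sum_add_distrib]
    refine (Finset.abs_sum_le_sum_abs _ _).trans (Finset.sum_le_sum fun i hi => ?_)
    have hi := Finset.mem_range.mp hi
    rw [hsymm i (by omega), Nat.sub_sub_self (by omega)]
    obtain ⟨h1, h2⟩ := hr i
    obtain ⟨h3, h4⟩ := hr (N - i)
    have e : scaledCatalan i * q i * ((1 - r i) * r (N - i)) +
        scaledCatalan i * q i * ((1 - r (N - i)) * r i) -
        scaledCatalan i * (r i + (1 - 2 * r i) * L) =
        scaledCatalan i * ((q i - 1) * (r i * (1 - r (N - i)) + (1 - r i) * r (N - i)) +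
          (1 - 2 * r i) * (r (N - i) - L)) := by ring
    rw [e, abs_mul, abs_of_nonneg (scaledCatalan_nonneg i), ← mul_add]
    refine mul_le_mul_of_nonneg_left ((abs_add_le _ _).trans (add_le_add ?_ ?_))
      (scaledCatalan_nonneg i)
    · rw [abs_mul]
      refine mul_le_of_le_one_right (abs_nonneg _) ?_
      rw [abs_le]
      constructor <;> nlinarith
    · rw [abs_mul]
      refine (mul_le_of_le_one_left (abs_nonneg _) ?_).trans (hb i hi)
      rw [abs_le]
      constructor <;> linarith
  have e3 : ∑ i ∈ range M, scaledCatalan i * b ≤ b / 2 := by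
    rw [← Finset.sum_mul]
    have := summable_scaledCatalan.sum_le_tsum (range M) fun i _ => scaledCatalan_nonneg i
    rw [tsum_scaledCatalan] at this
    nlinarith
  rw [e1] at hends
  rw [abs_le] at hends e2 hL ⊢
  constructor <;> linarith [hends.1, hends.2, e2.1, e2.2, hL.1, hL.2]

theorem tendsto_div_scaledCatalan (ha0 : a 0 = 0) (ha1 : a 1 = 1 / 8)
    (ha : ∀ n, ∑ p ∈ antidiagonal (n + 2), (scaledCatalan p.1 - a p.1) * a p.2 = a (n + 2)) :
    Tendsto (fun n => a n / scaledCatalan n) atTop (nhds ((3 - Real.sqrt 3) / 6)) := by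
  have hbd := nonneg_and_le_scaledCatalan ha0 ha1 ha
  obtain ⟨hs, hsum⟩ := tsum_eq_of_recurrence ha0 ha1 ha
  set r : ℕ → ℝ := fun n => a n / scaledCatalan n with hrdef
  set L : ℝ := (3 - Real.sqrt 3) / 6 with hLdef
  have hr (n : ℕ) : 0 ≤ r n ∧ r n ≤ 1 :=
    ⟨div_nonneg (hbd n).1 (scaledCatalan_nonneg n),
      div_le_one_of_le₀ (hbd n).2 (scaledCatalan_nonneg n)⟩
  have har (n : ℕ) : a n = scaledCatalan n * r n := by
    rcases n with _ | n
    · simp [ha0, scaledCatalan_zero]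
    · exact (mul_div_cancel₀ _ (scaledCatalan_succ_pos n).ne').symm
  have hrec (n : ℕ) : r (n + 2) * scaledCatalan (n + 2) = ∑ p ∈ antidiagonal (n + 2),
      scaledCatalan p.1 * scaledCatalan p.2 * ((1 - r p.1) * r p.2) := by
    rw [mul_comm, ← har, ← ha]
    refine Finset.sum_congr rfl fun p _ => ?_
    rw [har p.1, har p.2]
    ring
  have h3 : Real.sqrt 3 * Real.sqrt 3 = 3 := Real.mul_self_sqrt (by norm_num)
  have hL01 : 0 ≤ L ∧ L ≤ 1 := by
    have := Real.sqrt_nonneg 3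
    constructor <;> nlinarith
  have hLsum : HasSum (fun i => scaledCatalan i * (r i + (1 - 2 * r i) * L)) L := by
    have h := (hs.hasSum.mul_right (1 - 2 * L)).add
      (summable_scaledCatalan.hasSum.mul_right L)
    have hval : (Real.sqrt 3 - 1) / 4 * (1 - 2 * L) + 1 / 2 * L = L := by
      rw [hLdef]
      linarith
    rw [hsum, tsum_scaledCatalan, hval] at h
    refine h.congr_fun fun i => ?_
    rw [har i]
    ring
  have contract (b : ℝ) (hb : 0 < b) (h : ∀ᶠ n in atTop, |r n - L| ≤ b) :
      ∀ᶠ n in atTop, |r n - L| ≤ 3 / 4 * b := by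
    have t1 := hLsum.tendsto_sum_nat
    have t2 := summable_scaledCatalan.hasSum.tendsto_sum_nat
    rw [tsum_scaledCatalan] at t2
    have t3 : Tendsto (fun M => 1 - 2 * ∑ i ∈ range M, scaledCatalan i +
        |L - ∑ i ∈ range M, scaledCatalan i * (r i + (1 - 2 * r i) * L)|) atTop
        (nhds (1 - 2 * (1 / 2) + |L - L|)) :=
      (tendsto_const_nhds.sub (t2.const_mul 2)).add (tendsto_const_nhds.sub t1).abs
    obtain ⟨M, hM⟩ := (t3.eventually_lt_const (show _ < b / 4 by simpa using hb)).exists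
    have t4 : Tendsto (fun n => 1 - 2 * ∑ i ∈ range M, scaledCatalan i *
          (scaledCatalan (n - i) / scaledCatalan n) +
        ∑ i ∈ range M, scaledCatalan i *
          |scaledCatalan (n - i) / scaledCatalan n - 1| +
        |L - ∑ i ∈ range M, scaledCatalan i * (r i + (1 - 2 * r i) * L)|) atTop
        (nhds (1 - 2 * ∑ i ∈ range M, scaledCatalan i * 1 +
          ∑ i ∈ range M, scaledCatalan i * |(1 : ℝ) - 1| +
          |L - ∑ i ∈ range M, scaledCatalan i * (r i + (1 - 2 * r i) * L)|)) := by
      refine ((tendsto_const_nhds.sub (Tendsto.const_mul 2 (tendsto_finsetSum _ fun i _ =>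
        (tendsto_scaledCatalan_sub_div i).const_mul _))).add
        (tendsto_finsetSum _ fun i _ => Tendsto.const_mul _
          ((tendsto_scaledCatalan_sub_div i).sub tendsto_const_nhds).abs)).add
        tendsto_const_nhds
    have t5 := t4.eventually_lt_const (show _ < b / 4 by simpa using hM)
    obtain ⟨K, hK⟩ := eventually_atTop.mp h
    filter_upwards [t5, eventually_ge_atTop (K + 2 * M + 2)] with n hn hnK
    obtain ⟨m, rfl⟩ := Nat.exists_eq_add_of_le' (show 2 ≤ n by omega)
    have := abs_ratio_sub_le (M := M) hr le_rfl (by omega) hb.le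
      (fun i hi => hK (m + 2 - i) (by omega)) (hrec m)
    linarith
  have iter (k : ℕ) : ∀ᶠ n in atTop, |r n - L| ≤ (3 / 4) ^ k := by
    induction k with
    | zero =>
      refine Eventually.of_forall fun n => ?_
      rw [pow_zero, abs_le]
      constructor <;> linarith [(hr n).1, (hr n).2, hL01.1, hL01.2]
    | succ k ih =>
      rw [pow_succ']
      exact contract _ (by positivity) ih
  rw [Metric.tendsto_atTop']
  intro ε hε
  obtain ⟨k, hk⟩ := exists_pow_lt_of_lt_one hε (show (3 / 4 : ℝ) < 1 by norm_num)
  obtain ⟨K, hK⟩ := eventually_atTop.mp (iter k)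
  exact ⟨K, fun n hn => (hK n hn.le).trans_lt hk⟩

end Ratio

open Filter in
/-- The ratio `f n / g n` of false rows to total rows tends to `(3 - √3)/6`. -/
theorem false_to_total_ratio (f : ℕ → ℤ) (hf0 : f 0 = 0) (hf1 : f 1 = 1)
    (hf : ∀ n : ℕ, 2 ≤ n →
      f n = ∑ i ∈ Finset.Icc 1 (n - 1),
        ((2 : ℤ) ^ i * catalanC i - f i) * f (n - i)) :
    Tendsto (fun n : ℕ => (f n : ℝ) / ((2 : ℝ) ^ n * catalanC n))
      atTop (nhds ((3 - Real.sqrt 3) / 6)) := by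
  have h8 (n : ℕ) : (8 : ℝ) ^ n = 2 ^ n * 4 ^ n := by rw [← mul_pow]; norm_num
  have h := tendsto_div_scaledCatalan (a := fun n => (f n : ℝ) / 8 ^ n) (by simp [hf0])
    (by simp [hf1]) (by
      intro n
      have hsub : Finset.Icc 1 (n + 2 - 1) ⊆ range (n + 2 + 1) := fun i hi => by
        simp only [Finset.mem_Icc, Finset.mem_range] at *
        omega
      rw [Finset.Nat.sum_antidiagonal_eq_sum_range_succ
        (fun i j => (scaledCatalan i - (f i : ℝ) / 8 ^ i) * ((f j : ℝ) / 8 ^ j)),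
        hf (n + 2) (by omega), Int.cast_sum, Finset.sum_div, ← Finset.sum_subset hsub]
      · refine Finset.sum_congr rfl fun i hi => ?_
        have hi := Finset.mem_Icc.mp hi
        have hpow : (8 : ℝ) ^ (n + 2) = 8 ^ i * 8 ^ (n + 2 - i) := by
          rw [← pow_add]
          congr 1
          omega
        push_cast
        rw [hpow, scaledCatalan, h8 i]
        field_simp
      · intro i hi hi'
        simp only [Finset.mem_Icc, Finset.mem_range] at hi hi'
        obtain rfl | rfl : i = 0 ∨ i = n + 2 := by omega
        · simp [hf0, scaledCatalan_zero]
        · simp [hf0])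
  refine h.congr fun n => ?_
  rw [scaledCatalan, h8, div_div_eq_mul_div, mul_comm ((2 : ℝ) ^ n) (4 ^ n), ← div_div]
  field_simp
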